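/- Let Ω ⊆ ℂⁿ be open, let g : Ω → ℂ be holomorphic, and let x₀ ∈ Ω be a point such that g is not identically zero on any neighbourhood of x₀. Then there exists α₀ > 0 such that for every real α with 0 < α < α₀ there exists r > 0 with z ↦ ‖g(z)‖^(−2α) Lebesgue-integrable on the ball B(x₀, r). -/

import Mathlib

open MeasureTheory

noncomputable section

instance {n : ℕ} : MeasurableSpace (EuclideanSpace ℂ (Fin n)) := borel _
instance {n : ℕ} : BorelSpace (EuclideanSpace ℂ (Fin n)) := ⟨rfl⟩

/-- Sublevel set estimate: if the `k`-th derivative of a function is at least `δ` on an interval,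
then the function can only be smaller than `a ^ k * δ` on a set of measure at most `4 ^ k * a`. -/
theorem volume_sublevel_le (k : ℕ) : ∀ (F : ℕ → ℝ → ℝ) (I : Set ℝ) (a δ : ℝ), 0 < a → 0 < δ →
    I.OrdConnected → (∀ j, ∀ x ∈ I, HasDerivAt (F j) (F (j + 1) x) x) →
    (∀ x ∈ I, δ ≤ F k x) →
    volume {x ∈ I | |F 0 x| < a ^ k * δ} ≤ ENNReal.ofReal (4 ^ k * a) := by
  induction k with
  | zero =>
    intro F I a δ ha hδ hI hF hk
    have : {x ∈ I | |F 0 x| < a ^ 0 * δ} = ∅ := by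
      ext x
      simp only [Set.mem_ofPred_eq, Set.mem_empty_iff_false, iff_false, not_and, not_lt, pow_zero,
        one_mul]
      exact fun hx => (hk x hx).trans (le_abs_self _)
    rw [this]
    simp
  | succ k ih =>
    intro F I a δ ha hδ hI hF hk
    have hslope : ∀ x ∈ I, ∀ y ∈ I, x < y → δ * (y - x) ≤ F k y - F k x := by
      intro x hx y hy hxy
      have hsub : Set.Icc x y ⊆ I := hI.out hx hy
      obtain ⟨c, hc, hc'⟩ := exists_hasDerivAt_eq_slope (F k) (F (k + 1)) hxy
        (fun u hu => (hF k u (hsub hu)).continuousAt.continuousWithinAt)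
        (fun u hu => hF k u (hsub (Set.Ioo_subset_Icc_self hu)))
      have h1 := hk c (hsub (Set.Ioo_subset_Icc_self hc))
      rwa [hc', le_div_iff₀ (sub_pos.2 hxy)] at h1
    have hmono : ∀ x ∈ I, ∀ y ∈ I, x ≤ y → F k x ≤ F k y := by
      intro x hx y hy hxy
      rcases hxy.eq_or_lt with rfl | hlt
      · exact le_rfl
      · have := hslope x hx y hy hlt
        nlinarith [mul_pos hδ (sub_pos.2 hlt)]
    have haδ : 0 < a * δ := mul_pos ha hδ
    set I₁ : Set ℝ := {x ∈ I | F k x ≤ -(a * δ)}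
    set I₂ : Set ℝ := {x ∈ I | a * δ ≤ F k x}
    set I₀ : Set ℝ := {x ∈ I | |F k x| < a * δ}
    have hI₁ : I₁.OrdConnected := ⟨fun x hx y hy z hz =>
      have hzI := hI.out hx.1 hy.1 hz
      ⟨hzI, (hmono z hzI y hy.1 hz.2).trans hy.2⟩⟩
    have hI₂ : I₂.OrdConnected := ⟨fun x hx y hy z hz =>
      have hzI := hI.out hx.1 hy.1 hz
      ⟨hzI, hx.2.trans (hmono x hx.1 z hzI hz.1)⟩⟩
    have h₀ : volume I₀ ≤ ENNReal.ofReal (2 * a) := by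
      refine (Real.volume_le_diam _).trans (Metric.ediam_le fun x hx y hy => ?_)
      rw [edist_dist, Real.dist_eq]
      refine ENNReal.ofReal_le_ofReal ?_
      have key : ∀ x ∈ I₀, ∀ y ∈ I₀, x < y → y - x ≤ 2 * a := by
        intro x hx y hy hxy
        have h1 := hslope x hx.1 y hy.1 hxy
        have h2 := abs_lt.1 hx.2
        have h3 := abs_lt.1 hy.2
        have h4 : δ * (y - x) ≤ δ * (2 * a) := by linarith
        exact le_of_mul_le_mul_left h4 hδ
      rcases lt_trichotomy x y with h | h | h
      · rw [abs_sub_comm, abs_of_pos (sub_pos.2 h)]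
        exact key x hx y hy h
      · subst h
        simpa using ha.le
      · rw [abs_of_pos (sub_pos.2 h)]
        exact key y hy x hx h
    have h₁ := ih (fun j x => -F j x) I₁ a (a * δ) ha haδ hI₁
      (fun j x hx => (hF j x hx.1).neg) (fun x hx => by linarith [hx.2])
    have h₂ := ih F I₂ a (a * δ) ha haδ hI₂ (fun j x hx => hF j x hx.1) (fun x hx => hx.2)
    have hsub : {x ∈ I | |F 0 x| < a ^ (k + 1) * δ} ⊆
        I₀ ∪ ({x ∈ I₁ | |-F 0 x| < a ^ k * (a * δ)} ∪ {x ∈ I₂ | |F 0 x| < a ^ k * (a * δ)}) := by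
      rintro x ⟨hxI, hx⟩
      rw [pow_succ, mul_assoc] at hx
      by_cases h : |F k x| < a * δ
      · exact Or.inl ⟨hxI, h⟩
      · rcases le_abs'.1 (not_lt.1 h) with h | h
        · exact Or.inr (Or.inl ⟨⟨hxI, h⟩, by rwa [abs_neg]⟩)
        · exact Or.inr (Or.inr ⟨⟨hxI, h⟩, hx⟩)
    calc volume {x ∈ I | |F 0 x| < a ^ (k + 1) * δ}
        ≤ ENNReal.ofReal (2 * a) +
          (ENNReal.ofReal (4 ^ k * a) + ENNReal.ofReal (4 ^ k * a)) :=
        (measure_mono hsub).trans <| (measure_union_le _ _).trans <|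
          add_le_add h₀ <| (measure_union_le _ _).trans (add_le_add h₁ h₂)
      _ = ENNReal.ofReal (2 * a + (4 ^ k * a + 4 ^ k * a)) := by
        rw [← ENNReal.ofReal_add (by positivity) (by positivity),
          ← ENNReal.ofReal_add (by positivity) (by positivity)]
      _ ≤ ENNReal.ofReal (4 ^ (k + 1) * a) := by
        refine ENNReal.ofReal_le_ofReal ?_
        have h4 : (1 : ℝ) ≤ 4 ^ k := one_le_pow₀ (by norm_num)
        rw [pow_succ]
        nlinarith

section DirectionalDerivatives

variable {E : Type*} [NormedAddCommGroup E] [NormedSpace ℂ E]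

/-- The `j`-th iterated directional derivative of `g` in the direction `v`. -/
def iterDirDeriv (g : E → ℂ) (v : E) (j : ℕ) : E → ℂ :=
  (fun (f : E → ℂ) z => fderiv ℂ f z v)^[j] g

theorem iterDirDeriv_succ (g : E → ℂ) (v : E) (j : ℕ) (z : E) :
    iterDirDeriv g v (j + 1) z = fderiv ℂ (iterDirDeriv g v j) z v := by
  simp only [iterDirDeriv, Function.iterate_succ_apply']

theorem analyticOnNhd_iterDirDeriv {g : E → ℂ} {U : Set E} (hg : AnalyticOnNhd ℂ g U) (v : E)
    (j : ℕ) : AnalyticOnNhd ℂ (iterDirDeriv g v j) U := by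
  induction j with
  | zero => exact hg
  | succ j ih =>
    have h : iterDirDeriv g v (j + 1) = fun z => fderiv ℂ (iterDirDeriv g v j) z v :=
      funext fun z => iterDirDeriv_succ g v j z
    rw [h]
    exact fun z hz => ((ContinuousLinearMap.apply ℂ ℂ v).analyticAt _).comp (ih.fderiv z hz)

theorem hasDerivAt_iterDirDeriv {g : E → ℂ} {U : Set E} (hg : AnalyticOnNhd ℂ g U) (v z : E)
    (j : ℕ) (t : ℂ) (ht : z + t • v ∈ U) :
    HasDerivAt (fun s : ℂ => iterDirDeriv g v j (z + s • v))
      (iterDirDeriv g v (j + 1) (z + t • v)) t := by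
  have h1 : HasDerivAt (fun s : ℂ => z + s • v) v t := by
    simpa using ((hasDerivAt_id t).smul_const v).const_add z
  rw [iterDirDeriv_succ]
  exact ((analyticOnNhd_iterDirDeriv hg v j _ ht).differentiableAt.hasFDerivAt).comp_hasDerivAt t h1

/-- An analytic function that does not vanish identically near `x₀` has a nonzero iterated
directional derivative at `x₀`. -/
theorem exists_iterDirDeriv_ne_zero {g : E → ℂ} {U : Set E} (hg : AnalyticOnNhd ℂ g U)
    (hU : IsOpen U) {x₀ : E} (hx₀ : x₀ ∈ U) (hnz : ¬ ∀ᶠ z in nhds x₀, g z = 0) :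
    ∃ (v : E) (k : ℕ), iterDirDeriv g v k x₀ ≠ 0 := by
  obtain ⟨R, hR, hRU⟩ := Metric.isOpen_iff.1 hU x₀ hx₀
  have hgB : AnalyticOnNhd ℂ g (Metric.ball x₀ R) := hg.mono hRU
  obtain ⟨z₁, hz₁, hgz₁⟩ : ∃ z₁ ∈ Metric.ball x₀ R, g z₁ ≠ 0 := by
    by_contra! h
    exact hnz (Filter.eventually_of_mem (Metric.ball_mem_nhds x₀ hR) h)
  refine ⟨z₁ - x₀, ?_⟩
  by_contra! hall
  set v := z₁ - x₀
  set T : Set ℂ := {t | x₀ + t • v ∈ Metric.ball x₀ R}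
  have hT : IsOpen T := Metric.isOpen_ball.preimage (by fun_prop)
  have hTeq : T = {t : ℂ | ‖t‖ * ‖v‖ < R} := by
    ext t
    simp [T, norm_smul]
  have hTconv : Convex ℝ T := by
    rw [hTeq]
    intro s hs t ht a b ha hb hab
    simp only [Set.mem_ofPred_eq] at hs ht ⊢
    have h1 : ‖a • s + b • t‖ ≤ a * ‖s‖ + b * ‖t‖ := by
      refine (norm_add_le _ _).trans ?_
      rw [norm_smul, norm_smul, Real.norm_of_nonneg ha, Real.norm_of_nonneg hb]
    have h2 : ‖a • s + b • t‖ * ‖v‖ ≤ a * (‖s‖ * ‖v‖) + b * (‖t‖ * ‖v‖) := by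
      nlinarith [mul_le_mul_of_nonneg_right h1 (norm_nonneg v)]
    have h3 : a • (‖s‖ * ‖v‖) + b • (‖t‖ * ‖v‖) ∈ Set.Iio R :=
      (convex_Iio R) hs ht ha hb hab
    exact h2.trans_lt h3
  have h0 : (0 : ℂ) ∈ T := by simp [T, hR]
  have h1 : (1 : ℂ) ∈ T := by simpa [T, v] using mem_ball_iff_norm.1 hz₁
  set φ : ℂ → ℂ := fun t => g (x₀ + t • v)
  have hφ : AnalyticOnNhd ℂ φ T := by
    intro t ht
    have ha : AnalyticAt ℂ (fun t : ℂ => x₀ + t • v) t := by fun_prop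
    exact AnalyticAt.fun_comp (hgB _ ht) ha
  have hiter : ∀ j, ∀ t ∈ T, iteratedDeriv j φ t = iterDirDeriv g v j (x₀ + t • v) := by
    intro j
    induction j with
    | zero =>
      intro t _
      simp [φ, iterDirDeriv]
    | succ j ih =>
      intro t ht
      rw [iteratedDeriv_succ,
        Filter.EventuallyEq.deriv_eq (Filter.eventually_of_mem (hT.mem_nhds ht) ih)]
      exact (hasDerivAt_iterDirDeriv hgB v x₀ j t ht).deriv
  have htop : analyticOrderAt φ 0 = ⊤ := by
    refine ENat.eq_top_iff_forall_ge.2 fun m => ?_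
    refine (natCast_le_analyticOrderAt_iff_iteratedDeriv_eq_zero (hφ 0 h0)).2 fun i _ => ?_
    rw [hiter i 0 h0]
    simpa using hall i
  have hzero := hφ.eqOn_zero_of_preconnected_of_eventuallyEq_zero hTconv.isPreconnected h0
    (analyticOrderAt_eq_top.1 htop) h1
  exact hgz₁ (by simpa [φ, v] using hzero)

/-- If the real part of the `k`-th directional derivative of `g`, rotated by `c`, is bounded below
on a ball, then the sublevel sets of `g` in that ball have small Haar measure. -/
theorem measure_sublevel_le [MeasurableSpace E] [BorelSpace E] [ProperSpace E]
    (μ : Measure E) [μ.IsAddHaarMeasure] {g : E → ℂ} {x₀ : E} {ρ : ℝ}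
    (hg : AnalyticOnNhd ℂ g (Metric.ball x₀ ρ)) (v : E) (k : ℕ) (c : ℂ) {a δ : ℝ} (ha : 0 < a)
    (hδ : 0 < δ) (hk : ∀ z ∈ Metric.ball x₀ ρ, δ ≤ (c * iterDirDeriv g v k z).re) :
    μ {z ∈ Metric.ball x₀ ρ | ‖c * g z‖ < a ^ k * δ} ≤
      ENNReal.ofReal (4 ^ k * a) * μ (Metric.ball x₀ (ρ + ‖v‖)) := by
  set S : Set E := {z ∈ Metric.ball x₀ ρ | ‖c * g z‖ < a ^ k * δ}
  have hS : IsOpen S := by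
    have hc : ContinuousOn (fun z => ‖c * g z‖) (Metric.ball x₀ ρ) :=
      (continuousOn_const.mul hg.continuousOn).norm
    exact hc.isOpen_inter_preimage Metric.isOpen_ball isOpen_Iio
  have hline : ∀ z : E, volume {t : ℝ | z + (t : ℂ) • v ∈ S} ≤ ENNReal.ofReal (4 ^ k * a) := by
    intro z
    set I : Set ℝ := {t | z + (t : ℂ) • v ∈ Metric.ball x₀ ρ}
    have hI : I.OrdConnected := by
      refine Convex.ordConnected fun s hs t ht p q hp hq hpq => ?_
      simp only [I, Set.mem_ofPred_eq, mem_ball_iff_norm] at hs ht ⊢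
      have heq : z + ((p • s + q • t : ℝ) : ℂ) • v - x₀ =
          (p : ℂ) • (z + (s : ℂ) • v - x₀) + (q : ℂ) • (z + (t : ℂ) • v - x₀) := by
        have hpq' : (p : ℂ) = 1 - q := by
          rw [← Complex.ofReal_one, ← hpq]
          push_cast
          ring
        simp only [smul_eq_mul, Complex.ofReal_add, Complex.ofReal_mul, hpq']
        module
      have h1 : p • ‖z + (s : ℂ) • v - x₀‖ + q • ‖z + (t : ℂ) • v - x₀‖ ∈ Set.Iio ρ :=
        (convex_Iio ρ) hs ht hp hq hpq
      refine lt_of_le_of_lt ?_ h1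
      rw [heq]
      refine (norm_add_le _ _).trans ?_
      rw [norm_smul, norm_smul, Complex.norm_of_nonneg hp, Complex.norm_of_nonneg hq]
      rfl
    refine (measure_mono ?_).trans (volume_sublevel_le k
      (fun j t => (c * iterDirDeriv g v j (z + (t : ℂ) • v)).re) I a δ ha hδ hI
      (fun j t ht => ?_) (fun t ht => hk _ ht))
    · intro t ht
      exact ⟨ht.1, (Complex.abs_re_le_norm _).trans_lt ht.2⟩
    · exact ((hasDerivAt_iterDirDeriv hg v z j t ht).const_mul c).real_of_complex
  have hmeas : Measurable
      (fun p : ℝ × E => S.indicator (1 : E → ENNReal) (p.2 + (p.1 : ℂ) • v)) := by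
    have : IsOpen {p : ℝ × E | p.2 + (p.1 : ℂ) • v ∈ S} := hS.preimage (by fun_prop)
    exact measurable_one.indicator this.measurableSet
  have hswap : ∫⁻ t in Set.Icc (0 : ℝ) 1, ∫⁻ z, S.indicator (1 : E → ENNReal) (z + (t : ℂ) • v) ∂μ =
      ∫⁻ z, (∫⁻ t in Set.Icc (0 : ℝ) 1, S.indicator (1 : E → ENNReal) (z + (t : ℂ) • v)) ∂μ :=
    lintegral_lintegral_swap hmeas.aemeasurable
  have hleft : ∫⁻ t in Set.Icc (0 : ℝ) 1, ∫⁻ z, S.indicator (1 : E → ENNReal) (z + (t : ℂ) • v) ∂μ =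
      μ S := by
    have : ∀ t : ℝ, ∫⁻ z, S.indicator (1 : E → ENNReal) (z + (t : ℂ) • v) ∂μ = μ S := fun t => by
      rw [lintegral_add_right_eq_self (μ := μ) (S.indicator (1 : E → ENNReal)),
        lintegral_indicator_one hS.measurableSet]
    simp only [this]
    simp
  rw [← hleft, hswap]
  calc ∫⁻ z, (∫⁻ t in Set.Icc (0 : ℝ) 1, S.indicator (1 : E → ENNReal) (z + (t : ℂ) • v)) ∂μ
      ≤ ∫⁻ z, (Metric.ball x₀ (ρ + ‖v‖)).indicator
          (fun _ => ENNReal.ofReal (4 ^ k * a)) z ∂μ := by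
        refine lintegral_mono fun z => ?_
        by_cases hz : z ∈ Metric.ball x₀ (ρ + ‖v‖)
        · rw [Set.indicator_of_mem hz]
          refine (lintegral_mono' Measure.restrict_le_self le_rfl).trans ?_
          refine le_trans (le_of_eq ?_) (hline z)
          have ho : IsOpen {t : ℝ | z + (t : ℂ) • v ∈ S} := hS.preimage (by fun_prop)
          exact lintegral_indicator_one ho.measurableSet
        · rw [Set.indicator_of_notMem hz]
          refine (setLIntegral_eq_zero measurableSet_Icc fun t ht => ?_).le
          refine Set.indicator_of_notMem (fun hmem => hz ?_) _
          have h1 := mem_ball_iff_norm.1 hmem.1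
          rw [mem_ball_iff_norm]
          have h2 : ‖(t : ℂ) • v‖ ≤ ‖v‖ := by
            rw [norm_smul, Complex.norm_of_nonneg ht.1]
            exact mul_le_of_le_one_left (norm_nonneg v) ht.2
          have h3 : z - x₀ = (z + (t : ℂ) • v - x₀) - (t : ℂ) • v := by abel
          rw [h3]
          exact (norm_sub_le _ _).trans_lt (by linarith)
    _ = ENNReal.ofReal (4 ^ k * a) * μ (Metric.ball x₀ (ρ + ‖v‖)) :=
        lintegral_indicator_const Metric.isOpen_ball.measurableSet _

end DirectionalDerivatives

/-- Polynomial decay of the measure of sublevel sets gives integrability of small negative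
powers. -/
theorem integrable_rpow_neg_of_measure_sublevel_le {X : Type*} [MeasurableSpace X] (ν : Measure X)
    [IsFiniteMeasure ν] {f : X → ℝ} (hf : AEMeasurable f ν) (hf0 : ∀ x, 0 ≤ f x) {m : ℕ}
    (hm : m ≠ 0) {K δ s : ℝ} (hδ : 0 < δ) (hs : 0 < s) (hsm : s * m < 1)
    (h : ∀ a : ℝ, 0 < a → ν {x | f x < a ^ m * δ} ≤ ENNReal.ofReal (K * a)) :
    Integrable (fun x => f x ^ (-s)) ν := by
  have hm0 : (0 : ℝ) < m := by exact_mod_cast Nat.pos_of_ne_zero hm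
  have hmeas : AEMeasurable (fun x => f x ^ (-s)) ν := hf.pow_const _
  have hnn : ∀ x, 0 ≤ f x ^ (-s) := fun x => Real.rpow_nonneg (hf0 x) _
  refine ⟨hmeas.aestronglyMeasurable, ?_⟩
  rw [hasFiniteIntegral_iff_ofReal (Filter.Eventually.of_forall hnn),
    lintegral_eq_lintegral_meas_lt ν (Filter.Eventually.of_forall hnn) hmeas]
  have hsplit : Set.Ioi (0 : ℝ) = Set.Ioc 0 1 ∪ Set.Ioi 1 :=
    (Set.Ioc_union_Ioi_eq_Ioi zero_le_one).symm
  rw [hsplit]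
  refine (lintegral_union_le _ _ _).trans_lt (ENNReal.add_lt_top.2 ⟨?_, ?_⟩)
  · refine (lintegral_mono fun t => measure_mono (Set.subset_univ _)).trans_lt ?_
    simp
  · have hint : IntegrableOn (fun t : ℝ => K * (δ ^ (-(1 / m : ℝ)) * t ^ (-(1 / (s * m)))))
        (Set.Ioi 1) volume := by
      refine ((integrableOn_Ioi_rpow_of_lt ?_ one_pos).const_mul _).const_mul _
      rw [neg_lt_neg_iff]
      exact (one_lt_div (by positivity)).2 hsm
    refine lt_of_le_of_lt (setLIntegral_mono' measurableSet_Ioi fun t ht => ?_)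
      hint.lintegral_lt_top
    have ht0 : 0 < t := zero_lt_one.trans ht
    have hA : 0 < t ^ (-(1 / s)) / δ := div_pos (Real.rpow_pos_of_pos ht0 _) hδ
    have ha : 0 < (t ^ (-(1 / s)) / δ) ^ (1 / m : ℝ) := Real.rpow_pos_of_pos hA _
    have hpow : ((t ^ (-(1 / s)) / δ) ^ (1 / m : ℝ)) ^ m * δ = t ^ (-(1 / s)) := by
      rw [one_div (m : ℝ), Real.rpow_inv_natCast_pow hA.le hm, div_mul_cancel₀ _ hδ.ne']
    have haeq : (t ^ (-(1 / s)) / δ) ^ (1 / m : ℝ) =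
        δ ^ (-(1 / m : ℝ)) * t ^ (-(1 / (s * m))) := by
      rw [Real.div_rpow (Real.rpow_nonneg ht0.le _) hδ.le, ← Real.rpow_mul ht0.le,
        Real.rpow_neg hδ.le, div_eq_inv_mul]
      congr 2
      field_simp
    rw [← haeq]
    refine (measure_mono fun x hx => ?_).trans (h _ ha)
    simp only [Set.mem_ofPred_eq] at hx ⊢
    rw [hpow]
    have hfx : 0 < f x := by
      refine (hf0 x).lt_of_ne fun h0 => ?_
      rw [← h0, Real.zero_rpow (by linarith)] at hx
      linarith
    have h1 : (f x ^ (-s)) ^ (-(1 / s)) < t ^ (-(1 / s)) :=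
      Real.rpow_lt_rpow_of_neg ht0 hx (by simpa using hs)
    rwa [← Real.rpow_mul hfx.le, neg_mul_neg, mul_one_div_cancel hs.ne', Real.rpow_one] at h1

/-- A holomorphic function not vanishing identically near `x₀` has integrable small negative powers
with respect to Haar measure. -/
theorem exists_integrableOn_norm_rpow_neg {E : Type*} [NormedAddCommGroup E] [NormedSpace ℂ E]
    [MeasurableSpace E] [BorelSpace E] [ProperSpace E] (μ : Measure E) [μ.IsAddHaarMeasure]
    {g : E → ℂ} {U : Set E} (hg : AnalyticOnNhd ℂ g U) (hU : IsOpen U) {x₀ : E} (hx₀ : x₀ ∈ U)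
    (hnz : ¬ ∀ᶠ z in nhds x₀, g z = 0) :
    ∃ s₀ > (0 : ℝ), ∃ ρ > (0 : ℝ), ∀ s, 0 < s → s < s₀ →
      IntegrableOn (fun z => ‖g z‖ ^ (-s)) (Metric.ball x₀ ρ) μ := by
  obtain ⟨v, k, hk⟩ := exists_iterDirDeriv_ne_zero hg hU hx₀ hnz
  set c : ℂ := (iterDirDeriv g v k x₀)⁻¹
  have hc : 0 < ‖c‖ := norm_pos_iff.2 (inv_ne_zero hk)
  have hcont : ContinuousAt (fun z => (c * iterDirDeriv g v k z).re) x₀ :=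
    Complex.continuous_re.continuousAt.comp
      (continuousAt_const.mul (analyticOnNhd_iterDirDeriv hg v k x₀ hx₀).continuousAt)
  have hev : ∀ᶠ z in nhds x₀, (1 / 2 : ℝ) < (c * iterDirDeriv g v k z).re := by
    refine hcont.eventually_const_lt ?_
    have h1 : c * iterDirDeriv g v k x₀ = 1 := inv_mul_cancel₀ hk
    simp only [h1, Complex.one_re]
    norm_num
  obtain ⟨ρ, hρ, hball⟩ := Metric.mem_nhds_iff.1 (Filter.inter_mem hev (hU.mem_nhds hx₀))
  have hgB : AnalyticOnNhd ℂ g (Metric.ball x₀ ρ) := hg.mono fun z hz => (hball hz).2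
  set B := Metric.ball x₀ ρ
  set M : ℝ := (μ (Metric.ball x₀ (ρ + ‖v‖))).toReal
  have hM : μ (Metric.ball x₀ (ρ + ‖v‖)) = ENNReal.ofReal M :=
    (ENNReal.ofReal_toReal measure_ball_lt_top.ne).symm
  have hM0 : 0 ≤ M := ENNReal.toReal_nonneg
  have hBM : μ B ≤ ENNReal.ofReal M := by
    rw [← hM]
    exact measure_mono (Metric.ball_subset_ball (by linarith [norm_nonneg v]))
  refine ⟨1 / ((k + 1 : ℕ) : ℝ), by positivity, ρ, hρ, fun s hs hs' => ?_⟩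
  have : IsFiniteMeasure (μ.restrict B) := ⟨by simpa [B] using measure_ball_lt_top⟩
  refine integrable_rpow_neg_of_measure_sublevel_le (μ.restrict B) (m := k + 1) (K := 4 ^ k * M)
    (δ := 1 / 2 / ‖c‖) ?_ (fun _ => norm_nonneg _) k.succ_ne_zero (by positivity) hs
    ((lt_div_iff₀ (by positivity)).1 hs') fun a ha => ?_
  · exact (hgB.continuousOn.norm.aestronglyMeasurable Metric.isOpen_ball.measurableSet).aemeasurable
  rw [Measure.restrict_apply' Metric.isOpen_ball.measurableSet]
  have h4 : (1 : ℝ) ≤ 4 ^ k := one_le_pow₀ (by norm_num)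
  rcases le_total a 1 with ha1 | ha1
  · refine (measure_mono ?_).trans ((measure_sublevel_le μ hgB v k c ha one_half_pos
      fun z hz => (hball hz).1.le).trans_eq ?_)
    · rintro z ⟨hz, hzB⟩
      refine ⟨hzB, ?_⟩
      simp only [Set.mem_ofPred_eq] at hz
      rw [← mul_div_assoc, lt_div_iff₀ hc] at hz
      rw [norm_mul, mul_comm]
      refine hz.trans_le (mul_le_mul_of_nonneg_right ?_ (by norm_num))
      exact pow_le_pow_of_le_one ha.le ha1 k.le_succ
    · rw [hM, ← ENNReal.ofReal_mul (by positivity)]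
      congr 1
      ring
  · refine (measure_mono Set.inter_subset_right).trans (hBM.trans (ENNReal.ofReal_le_ofReal ?_))
    have h5 : M ≤ 4 ^ k * M := le_mul_of_one_le_left hM0 h4
    exact h5.trans (le_mul_of_one_le_right (by positivity) ha1)

/-- If `g` is holomorphic on `Ω` and not identically zero near `x₀ ∈ Ω`, then for all
sufficiently small `α > 0` the weight `‖g‖^(-2α)` is integrable on a small ball around
`x₀`, i.e. the multiplier ideal of `log |g|^{2α}` is trivial for small `α`. -/
theorem multiplier_ideal_trivial_small_alpha {n : ℕ}
    (Ω : Set (EuclideanSpace ℂ (Fin n))) (hΩ : IsOpen Ω)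
    (g : EuclideanSpace ℂ (Fin n) → ℂ) (hg : AnalyticOnNhd ℂ g Ω)
    (x₀ : EuclideanSpace ℂ (Fin n)) (hx₀ : x₀ ∈ Ω)
    (hnz : ¬ (∀ᶠ z in nhds x₀, g z = 0)) :
    ∃ α₀ > (0 : ℝ), ∀ α : ℝ, 0 < α → α < α₀ →
      ∃ r > (0 : ℝ),
        IntegrableOn (fun z => ‖g z‖ ^ (-(2 * α))) (Metric.ball x₀ r) volume := by
  obtain ⟨s₀, hs₀, ρ, hρ, h⟩ := exists_integrableOn_norm_rpow_neg volume hg hΩ hx₀ hnz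
  exact ⟨s₀ / 2, by positivity, fun α hα hα' =>
    ⟨ρ, hρ, h (2 * α) (by positivity) (by linarith)⟩⟩
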